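/- Equi-Lipschitz continuity in time of the semi-discrete Lagrangian scheme. Let V be a probability vector field satisfying (H1) with constant C > 0, let T > 0 and μ₀ ∈ 𝒫_c(ℝ^d) with supp(μ₀) ⊂ B(0,R). Then there exists a constant K = K(R,T) > 0 (one may take K = C(1 + e^{CT}(R+1))) such that for every N ∈ ℕ, W(μ̄^N_t, μ̄^N_s) ≤ K|t − s| for all t, s ∈ [0,T]. -/

import Mathlib

open MeasureTheory Set Filter Topology Metric
open scoped ENNReal NNReal Classical

noncomputable section

abbrev Euc (d : ℕ) : Type := EuclideanSpace ℝ (Fin d)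

/-- The (topological) support of a measure. -/
def msupp {X : Type*} [TopologicalSpace X] [MeasurableSpace X] (μ : Measure X) : Set X :=
  {x | ∀ U : Set X, IsOpen U → x ∈ U → 0 < μ U}

/-- Compactly supported Borel probability measures (membership in `𝒫_c`). -/
def Pc {X : Type*} [TopologicalSpace X] [MeasurableSpace X] (μ : Measure X) : Prop :=
  IsProbabilityMeasure μ ∧ ∃ K : Set X, IsCompact K ∧ μ Kᶜ = 0

/-- A probability vector field: `π₁ ♯ V[μ] = μ`. -/
def IsPVF {d : ℕ} (V : Measure (Euc d) → Measure (Euc d × Euc d)) : Prop :=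
  ∀ μ : Measure (Euc d), IsProbabilityMeasure μ →
    IsProbabilityMeasure (V μ) ∧ (V μ).map Prod.fst = μ

/-- Solution of the measure differential equation `μ̇_t = V[μ_t]` on `[0,T]`. -/
def IsMDESol {d : ℕ} (T : ℝ) (V : Measure (Euc d) → Measure (Euc d × Euc d))
    (μ : ℝ → Measure (Euc d)) : Prop :=
  ∀ f : Euc d → ℝ, ContDiff ℝ (⊤ : ℕ∞) f → HasCompactSupport f →
    IntegrableOn (fun t => ∫ p : Euc d × Euc d, fderiv ℝ f p.1 p.2 ∂(V (μ t))) (Icc 0 T) ∧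
    ∀ t ∈ Icc (0 : ℝ) T,
      (∫ x, f x ∂(μ t)) - (∫ x, f x ∂(μ 0)) =
        ∫ s in Icc (0 : ℝ) t, (∫ p : Euc d × Euc d, fderiv ℝ f p.1 p.2 ∂(V (μ s)))

/-- 1-Wasserstein distance via the Kantorovich–Rubinstein duality. -/
def W1 {X : Type*} [MeasurableSpace X] [PseudoMetricSpace X] (μ ν : Measure X) : ℝ :=
  ⨆ f : {f : X → ℝ // LipschitzWith 1 f}, ((∫ x, f.1 x ∂μ) - ∫ x, f.1 x ∂ν)

/-- Disintegration `ν_x[·]` of a measure on a product space w.r.t. the first projection. -/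
def disint {d : ℕ} (m : Measure (Euc d × Euc d)) : Euc d → Measure (Euc d) :=
  if h : IsFiniteMeasure m then
    haveI := h
    fun x => m.condKernel x
  else fun _ => 0

/-- Barycenter of the disintegration: `x ↦ ∫ v dν_x(v)`. -/
def bary {d : ℕ} (m : Measure (Euc d × Euc d)) (x : Euc d) : Euc d :=
  ∫ v, v ∂(disint m x)


section Hypotheses

/-- Condition (H1) with a given constant `C`. -/
def H1cond {d : ℕ} (C : ℝ) (V : Measure (Euc d) → Measure (Euc d × Euc d)) : Prop :=
  ∀ μ : Measure (Euc d), Pc μ →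
    ∀ p ∈ msupp (V μ), ‖p.2‖ ≤ C * (1 + ⨆ x : msupp μ, ‖(x : Euc d)‖)

/-- Hypothesis (H1): sublinearity of the PVF. -/
def H1 {d : ℕ} (V : Measure (Euc d) → Measure (Euc d × Euc d)) : Prop :=
  ∃ C > 0, H1cond C V

/-- Hypothesis (H2): continuity of the PVF `V : 𝒫_c(ℝ^d) → 𝒫_c(Tℝ^d)` w.r.t. Wasserstein. -/
def H2 {d : ℕ} (V : Measure (Euc d) → Measure (Euc d × Euc d)) : Prop :=
  (∀ μ, Pc μ → Pc (V μ)) ∧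
  ∀ μ, Pc μ → ∀ ε > 0, ∃ δ > 0, ∀ ν, Pc ν → W1 μ ν < δ → W1 (V μ) (V ν) < ε

/-- Transference plans between two measures. -/
def Couplings {X Y : Type*} [MeasurableSpace X] [MeasurableSpace Y]
    (μ : Measure X) (ν : Measure Y) : Set (Measure (X × Y)) :=
  {π | π.map Prod.fst = μ ∧ π.map Prod.snd = ν}

/-- 1-Wasserstein distance as infimum over transference plans. -/
def Wplan {X : Type*} [MeasurableSpace X] [PseudoMetricSpace X] (μ ν : Measure X) : ℝ :=
  sInf ((fun π : Measure (X × X) => ∫ p, dist p.1 p.2 ∂π) '' Couplings μ ν)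

/-- Optimal transference plans. -/
def OptCouplings {X : Type*} [MeasurableSpace X] [PseudoMetricSpace X] (μ ν : Measure X) :
    Set (Measure (X × X)) :=
  {π | π ∈ Couplings μ ν ∧ (∫ p, dist p.1 p.2 ∂π) = Wplan μ ν}

/-- The quantity `𝒲(V₁,V₂)`: minimal fiber displacement over plans whose base marginal is
an optimal plan between the two base measures. -/
def Wfib {d : ℕ} (V₁ V₂ : Measure (Euc d × Euc d)) : ℝ :=
  sInf ((fun P : Measure ((Euc d × Euc d) × (Euc d × Euc d)) => ∫ q, ‖q.1.2 - q.2.2‖ ∂P) ''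
    {P | P ∈ Couplings V₁ V₂ ∧
      P.map (fun q => (q.1.1, q.2.1)) ∈ OptCouplings (V₁.map Prod.fst) (V₂.map Prod.fst)})

/-- Hypothesis (H3): local Lipschitz continuity of the PVF in the `μ` variable. -/
def H3 {d : ℕ} (V : Measure (Euc d) → Measure (Euc d × Euc d)) : Prop :=
  ∀ R > 0, ∃ L > 0, ∀ μ ν : Measure (Euc d), Pc μ → Pc ν →
    msupp μ ⊆ ball (0 : Euc d) R → msupp ν ⊆ ball (0 : Euc d) R →
    Wfib (V μ) (V ν) ≤ L * W1 μ ν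

end Hypotheses

section Schemes

/-- The semi-discrete (in time) Lagrangian scheme at grid times `t_k = k T/N`. -/
def lagrStep {d : ℕ} (T : ℝ) (N : ℕ) (V : Measure (Euc d) → Measure (Euc d × Euc d))
    (μ₀ : Measure (Euc d)) : ℕ → Measure (Euc d)
  | 0 => μ₀
  | k + 1 => (V (lagrStep T N V μ₀ k)).map fun p => p.1 + (T / N) • p.2

/-- Time interpolation of the semi-discrete Lagrangian scheme. -/
def lagrT {d : ℕ} (T : ℝ) (N : ℕ) (V : Measure (Euc d) → Measure (Euc d × Euc d))
    (μ₀ : Measure (Euc d)) (t : ℝ) : Measure (Euc d) :=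
  if t ≤ 0 then μ₀
  else
    (V (lagrStep T N V μ₀ (⌈t / (T / N)⌉.toNat - 1))).map fun p =>
      p.1 + (t - (↑(⌈t / (T / N)⌉.toNat - 1) : ℝ) * (T / N)) • p.2

/-- The mean velocity scheme at grid times `t_j = j T/N`. -/
def mvelStep {d : ℕ} (T : ℝ) (N : ℕ) (V : Measure (Euc d) → Measure (Euc d × Euc d))
    (μ₀ : Measure (Euc d)) : ℕ → Measure (Euc d)
  | 0 => μ₀
  | j + 1 => (mvelStep T N V μ₀ j).map fun x =>
      x + (T / N) • bary (V (mvelStep T N V μ₀ j)) x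

/-- Time interpolation of the mean velocity scheme. -/
def mvelT {d : ℕ} (T : ℝ) (N : ℕ) (V : Measure (Euc d) → Measure (Euc d × Euc d))
    (μ₀ : Measure (Euc d)) (t : ℝ) : Measure (Euc d) :=
  if t ≤ 0 then μ₀
  else
    (mvelStep T N V μ₀ (⌈t / (T / N)⌉.toNat - 1)).map fun x =>
      x + (t - (↑(⌈t / (T / N)⌉.toNat - 1) : ℝ) * (T / N)) •
        bary (V (mvelStep T N V μ₀ (⌈t / (T / N)⌉.toNat - 1))) x

end Schemes

/-- In a second countable space a measure is concentrated on its support. -/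
theorem ae_mem_msupp {X : Type*} [TopologicalSpace X] [SecondCountableTopology X]
    [MeasurableSpace X] (μ : Measure X) : ∀ᵐ x ∂μ, x ∈ msupp μ := by
  rw [ae_iff]
  refine measure_null_of_locally_null _ fun x hx => ?_
  simp only [msupp, mem_ofPred_eq, not_forall, not_lt, nonpos_iff_eq_zero] at hx
  obtain ⟨U, hU, hxU, h0⟩ := hx
  exact ⟨U, mem_nhdsWithin_of_mem_nhds (hU.mem_nhds hxU), h0⟩

/-- The support is contained in every closed set of full measure. -/
theorem mem_of_mem_msupp {X : Type*} [TopologicalSpace X] [MeasurableSpace X] {μ : Measure X}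
    {K : Set X} (hK : IsClosed K) (h : ∀ᵐ x ∂μ, x ∈ K) {x : X} (hx : x ∈ msupp μ) : x ∈ K := by
  by_contra hxK
  exact (hx Kᶜ hK.isOpen_compl hxK).ne' h

/-- Under (H1), the velocities charged by `V μ` are bounded in terms of the size of the
region charged by `μ`. -/
theorem H1cond.ae_norm_le {d : ℕ} {C : ℝ} {V : Measure (Euc d) → Measure (Euc d × Euc d)}
    (h1 : H1cond C V) (hC : 0 ≤ C) {μ : Measure (Euc d)} [IsProbabilityMeasure μ] {M : ℝ}
    (hM : 0 ≤ M) (hμ : ∀ᵐ x ∂μ, ‖x‖ ≤ M) : ∀ᵐ p ∂(V μ), ‖p.2‖ ≤ C * (1 + M) := by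
  have hball : ∀ᵐ x ∂μ, x ∈ closedBall (0 : Euc d) M := by
    simpa only [mem_closedBall_zero_iff] using hμ
  have hPc : Pc μ := ⟨inferInstance, closedBall 0 M, isCompact_closedBall _ _, hball⟩
  filter_upwards [ae_mem_msupp (V μ)] with p hp
  refine (h1 μ hPc p hp).trans (mul_le_mul_of_nonneg_left (add_le_add_right ?_ 1) hC)
  exact Real.iSup_le
    (fun x => mem_closedBall_zero_iff.1 (mem_of_mem_msupp isClosed_closedBall hball x.2)) hM

/-- The base points charged by `V μ` are those charged by `μ`. -/
theorem IsPVF.ae_norm_fst_le {d : ℕ} {V : Measure (Euc d) → Measure (Euc d × Euc d)}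
    (hV : IsPVF V) {μ : Measure (Euc d)} [IsProbabilityMeasure μ] {M : ℝ}
    (hμ : ∀ᵐ x ∂μ, ‖x‖ ≤ M) : ∀ᵐ p ∂(V μ), ‖p.1‖ ≤ M := by
  rw [← (hV μ inferInstance).2] at hμ
  exact ae_of_ae_map measurable_fst.aemeasurable hμ

theorem measurable_fst_add_smul_snd {d : ℕ} (a : ℝ) :
    Measurable fun p : Euc d × Euc d => p.1 + a • p.2 :=
  (continuous_fst.add (continuous_snd.const_smul a)).measurable

/-- Integrals of a `1`-Lipschitz function along straight-line transport with speed bounded by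
`S` are `S`-Lipschitz in time. -/
theorem abs_integral_map_sub_le {d : ℕ} {m : Measure (Euc d × Euc d)} [IsProbabilityMeasure m]
    {M S : ℝ} (hM : ∀ᵐ p ∂m, ‖p.1‖ ≤ M) (hS : ∀ᵐ p ∂m, ‖p.2‖ ≤ S) {f : Euc d → ℝ}
    (hf : LipschitzWith 1 f) (a b : ℝ) :
    |(∫ x, f x ∂(m.map fun p => p.1 + a • p.2)) - ∫ x, f x ∂(m.map fun p => p.1 + b • p.2)| ≤
      S * |a - b| := by
  have hint (c : ℝ) : Integrable (fun p : Euc d × Euc d => f (p.1 + c • p.2)) m := by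
    refine Integrable.of_bound (hf.continuous.comp
      (continuous_fst.add (continuous_snd.const_smul c))).aestronglyMeasurable
      (|f 0| + (M + |c| * S)) ?_
    filter_upwards [hM, hS] with p h1 h2
    have h3 := hf.dist_le_mul (p.1 + c • p.2) 0
    rw [Real.dist_eq, dist_zero_right, NNReal.coe_one, one_mul] at h3
    have h4 : ‖p.1 + c • p.2‖ ≤ M + |c| * S := by
      refine (norm_add_le _ _).trans (add_le_add h1 ?_)
      rw [norm_smul, Real.norm_eq_abs]
      gcongr
    have h5 := abs_sub_abs_le_abs_sub (f (p.1 + c • p.2)) (f 0)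
    rw [Real.norm_eq_abs]
    linarith
  rw [integral_map (measurable_fst_add_smul_snd a).aemeasurable
      hf.continuous.aestronglyMeasurable,
    integral_map (measurable_fst_add_smul_snd b).aemeasurable
      hf.continuous.aestronglyMeasurable, ← integral_sub (hint a) (hint b), ← Real.norm_eq_abs]
  have hbound := norm_integral_le_of_norm_le_const (μ := m) (C := S * |a - b|)
    (f := fun p : Euc d × Euc d => f (p.1 + a • p.2) - f (p.1 + b • p.2)) (by
      filter_upwards [hS] with p hp
      have h3 := hf.dist_le_mul (p.1 + a • p.2) (p.1 + b • p.2)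
      rw [dist_add_left, dist_eq_norm, dist_eq_norm, ← sub_smul, norm_smul, NNReal.coe_one,
        one_mul, Real.norm_eq_abs (a - b)] at h3
      refine h3.trans ?_
      rw [mul_comm]
      gcongr)
  simpa using hbound

theorem isProbabilityMeasure_lagrStep {d : ℕ} (T : ℝ) (N : ℕ)
    {V : Measure (Euc d) → Measure (Euc d × Euc d)} (hV : IsPVF V) {μ₀ : Measure (Euc d)}
    (hμ₀ : IsProbabilityMeasure μ₀) (k : ℕ) : IsProbabilityMeasure (lagrStep T N V μ₀ k) := by
  induction k with
  | zero => exact hμ₀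
  | succ k ih =>
    have := (hV _ ih).1
    exact Measure.isProbabilityMeasure_map (measurable_fst_add_smul_snd _).aemeasurable

/-- The discrete Gronwall bound on the region charged by the scheme at grid times. -/
theorem ae_norm_le_lagrStep {d : ℕ} {T : ℝ} (hT : 0 ≤ T) (N : ℕ)
    {V : Measure (Euc d) → Measure (Euc d × Euc d)} (hV : IsPVF V) {C : ℝ} (hC : 0 ≤ C)
    (h1 : H1cond C V) {μ₀ : Measure (Euc d)} (hμ₀ : IsProbabilityMeasure μ₀) {R : ℝ}
    (hR : 0 ≤ R) (hsupp : ∀ᵐ x ∂μ₀, ‖x‖ ≤ R) (k : ℕ) :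
    ∀ᵐ x ∂(lagrStep T N V μ₀ k), ‖x‖ ≤ (1 + C * (T / N)) ^ k * (R + 1) - 1 := by
  have hh : 0 ≤ T / N := by positivity
  have hpow (k : ℕ) : (1 : ℝ) ≤ (1 + C * (T / N)) ^ k :=
    one_le_pow₀ (by linarith [mul_nonneg hC hh])
  induction k with
  | zero => simpa [lagrStep] using hsupp
  | succ k ih =>
    have := isProbabilityMeasure_lagrStep T N hV hμ₀ k
    have hM : 0 ≤ (1 + C * (T / N)) ^ k * (R + 1) - 1 := by nlinarith [hpow k]
    refine (ae_map_iff (measurable_fst_add_smul_snd _).aemeasurable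
      (measurableSet_le measurable_norm measurable_const)).2 ?_
    filter_upwards [hV.ae_norm_fst_le ih, h1.ae_norm_le hC hM ih] with p hp1 hp2
    calc ‖p.1 + (T / N) • p.2‖ ≤ ‖p.1‖ + (T / N) * ‖p.2‖ := by
          refine (norm_add_le _ _).trans_eq ?_
          rw [norm_smul, Real.norm_of_nonneg hh]
      _ ≤ ((1 + C * (T / N)) ^ k * (R + 1) - 1) +
          (T / N) * (C * (1 + ((1 + C * (T / N)) ^ k * (R + 1) - 1))) := by gcongr
      _ = (1 + C * (T / N)) ^ (k + 1) * (R + 1) - 1 := by ring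

/-- On the closed `k`-th time interval the scheme is straight-line transport from its value at
the left endpoint. -/
theorem lagrT_eq_map {d : ℕ} {T : ℝ} (hT : 0 < T) {N : ℕ} (hN : 0 < N)
    {V : Measure (Euc d) → Measure (Euc d × Euc d)} (hV : IsPVF V) {μ₀ : Measure (Euc d)}
    (hμ₀ : IsProbabilityMeasure μ₀) {k : ℕ} {t : ℝ} (h1 : k * (T / N) ≤ t)
    (h2 : t ≤ (k + 1 : ℕ) * (T / N)) :
    lagrT T N V μ₀ t =
      (V (lagrStep T N V μ₀ k)).map fun p => p.1 + (t - k * (T / N)) • p.2 := by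
  have hh : 0 < T / N := by positivity
  have hindex {j : ℕ} {u : ℝ} (hj : j * (T / N) < u) (hj' : u ≤ (j + 1 : ℕ) * (T / N)) :
      ⌈u / (T / N)⌉.toNat - 1 = j := by
    have : ⌈u / (T / N)⌉ = (j + 1 : ℕ) := by
      rw [Int.ceil_eq_iff, lt_div_iff₀ hh, div_le_iff₀ hh]
      push_cast at hj' ⊢
      exact ⟨by simpa using hj, hj'⟩
    rw [this]
    simp
  rcases h1.lt_or_eq with hlt | rfl
  · have ht : ¬ t ≤ 0 := not_le.2 (lt_of_le_of_lt (by positivity) hlt)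
    simp only [lagrT, if_neg ht, hindex hlt h2]
  · have hfst := (hV _ (isProbabilityMeasure_lagrStep T N hV hμ₀ k)).2
    simp only [sub_self, zero_smul, add_zero]
    refine Eq.trans ?_ hfst.symm
    cases k with
    | zero => simp [lagrT, lagrStep]
    | succ j =>
      have ht : ¬ ((j + 1 : ℕ) : ℝ) * (T / N) ≤ 0 := not_le.2 (by positivity)
      have hj : (j : ℝ) * (T / N) < (j + 1 : ℕ) * (T / N) := by push_cast; linarith
      simp only [lagrT, if_neg ht, hindex hj le_rfl, lagrStep]
      congr! 4
      push_cast
      ring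

/-- A function that is `K`-Lipschitz on each cell of a uniform grid is `K`-Lipschitz on the
region covered by the cells. -/
theorem abs_sub_le_of_grid {g : ℝ → ℝ} {K h : ℝ} {N : ℕ}
    (hg : ∀ k < N, ∀ s t : ℝ, k * h ≤ s → s ≤ t → t ≤ (k + 1 : ℕ) * h →
      |g t - g s| ≤ K * (t - s)) {s t : ℝ} (hs : 0 ≤ s) (hst : s ≤ t) (ht : t ≤ N * h) :
    |g t - g s| ≤ K * (t - s) := by
  induction N generalizing s t with
  | zero =>
    have : t = s := le_antisymm (by simpa using ht.trans (by simpa using hs)) hst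
    simp [this]
  | succ k ih =>
    have ih' := @ih fun j hj => hg j (hj.trans k.lt_succ_self)
    rcases le_total t (k * h) with htk | htk
    · exact ih' hs hst htk
    rcases le_total s (k * h) with hsk | hsk
    · have h1 := ih' hs hsk le_rfl
      have h2 := hg k k.lt_succ_self _ _ le_rfl htk ht
      have h3 := abs_sub_le (g t) (g (k * h)) (g s)
      linarith
    · exact hg k k.lt_succ_self _ _ hsk hst ht

/-- equi-Lipschitz continuity in time of the semi-discrete Lagrangian
scheme: under (H1) with constant `C`, if `supp μ₀ ⊆ B(0,R)` then, with
`K = C(1 + e^{CT}(R+1))`, `W(μ̄^N_t, μ̄^N_s) ≤ K |t-s|` for all `t,s ∈ [0,T]` and all `N`. -/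
theorem lagrangian_equilipschitz {d : ℕ} (T : ℝ) (hT : 0 < T)
    (V : Measure (Euc d) → Measure (Euc d × Euc d)) (hV : IsPVF V)
    (C : ℝ) (hC : 0 < C) (h1 : H1cond C V)
    (μ₀ : Measure (Euc d)) (hμ₀ : Pc μ₀)
    (R : ℝ) (hR : msupp μ₀ ⊆ ball (0 : Euc d) R) :
    ∀ N : ℕ, 0 < N → ∀ t ∈ Icc (0 : ℝ) T, ∀ s ∈ Icc (0 : ℝ) T,
      W1 (lagrT T N V μ₀ t) (lagrT T N V μ₀ s) ≤
        C * (1 + Real.exp (C * T) * (R + 1)) * |t - s| := by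
  intro N hN t ht s hs
  have hprob := hμ₀.1
  have hh : 0 < T / N := by positivity
  have hsupp : ∀ᵐ x ∂μ₀, ‖x‖ < R := by
    filter_upwards [ae_mem_msupp μ₀] with x hx using mem_ball_zero_iff.1 (hR hx)
  have hR0 : 0 < R := by
    obtain ⟨x, hx⟩ := hsupp.exists
    exact (norm_nonneg x).trans_lt hx
  set K := C * (1 + Real.exp (C * T) * (R + 1))
  have hpiece (f : Euc d → ℝ) (hf : LipschitzWith 1 f) (k : ℕ) (hk : k < N) (s t : ℝ)
      (hs : k * (T / N) ≤ s) (hst : s ≤ t) (ht : t ≤ (k + 1 : ℕ) * (T / N)) :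
      |(∫ x, f x ∂(lagrT T N V μ₀ t)) - ∫ x, f x ∂(lagrT T N V μ₀ s)| ≤ K * (t - s) := by
    have := isProbabilityMeasure_lagrStep T N hV hprob k
    have := (hV _ this).1
    have hpow : (1 + C * (T / N)) ^ k ≤ Real.exp (C * T) := by
      calc (1 + C * (T / N)) ^ k ≤ (1 + C * (T / N)) ^ N :=
            pow_le_pow_right₀ (by linarith [mul_pos hC hh]) hk.le
        _ ≤ Real.exp (C * (T / N)) ^ N := by
            gcongr
            rw [add_comm]
            exact Real.add_one_le_exp _
        _ = Real.exp (C * T) := by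
            rw [← Real.exp_nat_mul]
            congr 1
            field_simp
    have hM : ∀ᵐ x ∂(lagrStep T N V μ₀ k), ‖x‖ ≤ Real.exp (C * T) * (R + 1) := by
      filter_upwards [ae_norm_le_lagrStep hT.le N hV hC.le h1 hprob hR0.le
        (hsupp.mono fun x hx => hx.le) k] with x hx
      nlinarith
    have key := abs_integral_map_sub_le (hV.ae_norm_fst_le hM)
      (h1.ae_norm_le hC.le (by positivity) hM) hf (t - k * (T / N)) (s - k * (T / N))
    rwa [← lagrT_eq_map hT hN hV hprob (hs.trans hst) ht,
      ← lagrT_eq_map hT hN hV hprob hs (hst.trans ht), sub_sub_sub_cancel_right,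
      abs_of_nonneg (sub_nonneg.2 hst)] at key
  have hNT : N * (T / N) = T := by field_simp
  have : Nonempty {f : Euc d → ℝ // LipschitzWith 1 f} :=
    ⟨⟨fun _ => 0, LipschitzWith.const' 0⟩⟩
  refine ciSup_le fun ⟨f, hf⟩ => (le_abs_self _).trans ?_
  rcases le_total s t with hst | hst
  · rw [abs_of_nonneg (sub_nonneg.2 hst)]
    exact abs_sub_le_of_grid (g := fun u => ∫ x, f x ∂(lagrT T N V μ₀ u)) (hpiece f hf) hs.1 hst
      (ht.2.trans_eq hNT.symm)
  · rw [abs_sub_comm, abs_sub_comm t, abs_of_nonneg (sub_nonneg.2 hst)]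
    exact abs_sub_le_of_grid (g := fun u => ∫ x, f x ∂(lagrT T N V μ₀ u)) (hpiece f hf) ht.1 hst
      (hs.2.trans_eq hNT.symm)

end
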